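/- (Bicriteria approximation via budget inflation) Suppose the value is additive, v(Ψ) = Σ_{i∈Ψ} v_i with v_i ≥ 0, and p_i ≥ 2c_i for all tasks i. Then there exist a set Ψ ⊆ [n] and a truncated separate scoring rule S with values in [0, 11] such that S is proper, exerting effort on exactly Ψ (followed by truthful reporting) maximizes the agent's expected utility over all effort sets, and v(Ψ) ≥ ALG-OPT(v, c), where ALG-OPT(v, c) is the maximum of v(Ψ') over Ψ' ⊆ [n] with Σ_{i∈Ψ'} c_i ≤ 1. -/

import Mathlib

open Finset

namespace KS

abbrev Sig (n : ℕ) := Fin n → Option Bool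
abbrev St (n : ℕ) := Fin n → Bool

/-- Posterior probability of state profile `ω` induced by signal profile `σ`:
`ω i = b` with probability 1 when `σ i = some b`, uniform when `σ i = none`. -/
noncomputable def postProb {n : ℕ} (σ : Sig n) (ω : St n) : ℝ :=
  ∏ i, (σ i).elim ((1:ℝ)/2) (fun b => if ω i = b then 1 else 0)

/-- Expectation of `f` over states, under the posterior induced by `σ`. -/
noncomputable def postExp {n : ℕ} (σ : Sig n) (f : St n → ℝ) : ℝ :=
  ∑ ω : St n, postProb σ ω * f ω

/-- A scoring rule is proper if truthful reporting of the signal maximizes the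
expected score under the induced posterior. -/
def Proper {n : ℕ} (S : Sig n → St n → ℝ) : Prop :=
  ∀ σ σ' : Sig n, postExp σ (S σ) ≥ postExp σ (S σ')

/-- Probability of receiving signal profile `σ` when exerting effort exactly on `Ψ`
(with state-revelation probabilities `p`, states uniform and independent). -/
noncomputable def sigProb {n : ℕ} (p : Fin n → ℝ) (Ψ : Finset (Fin n)) (σ : Sig n) : ℝ :=
  ∏ i, if i ∈ Ψ then (σ i).elim (1 - p i) (fun _ => p i / 2)
       else (σ i).elim 1 (fun _ => 0)

/-- Expected score `E_{σ∼Ψ}[E_{ω∼σ}[S(σ,ω)]]` for exerting effort on `Ψ` and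
truthfully reporting. -/
noncomputable def expScore {n : ℕ} (p : Fin n → ℝ) (Ψ : Finset (Fin n))
    (S : Sig n → St n → ℝ) : ℝ :=
  ∑ σ : Sig n, sigProb p Ψ σ * postExp σ (S σ)

/-- Incentive compatibility of the mechanism `(S, Ψ)`. -/
def IC {n : ℕ} (p c : Fin n → ℝ) (S : Sig n → St n → ℝ) (Ψ : Finset (Fin n)) : Prop :=
  Proper S ∧ ∀ Ψ' : Finset (Fin n),
    expScore p Ψ S - ∑ i ∈ Ψ, c i ≥ expScore p Ψ' S - ∑ i ∈ Ψ', c i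

/-- Truncated separate scoring rule with budget `B`. -/
def IsTruncSep {n : ℕ} (B : ℝ) (S : Sig n → St n → ℝ) : Prop :=
  ∃ (T : Fin n → Option Bool → Bool → ℝ) (d : ℝ),
    ∀ σ ω, S σ ω = min B (max 0 (-d + ∑ i, T i (σ i) (ω i)))

open Classical in
/-- Threshold scoring rule with recommendation set `Ψ` and threshold `η`. -/
noncomputable def thresholdScore {n : ℕ} (Ψ : Finset (Fin n)) (η : ℕ)
    (σ : Sig n) (ω : St n) : ℝ :=
  if ∃ i ∈ Ψ, σ i ≠ none ∧ σ i ≠ some (ω i) then 0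
  else if η ≤ (Ψ.filter fun i => σ i = some (ω i)).card then 1
  else (1/2 : ℝ) ^ (η - (Ψ.filter fun i => σ i = some (ω i)).card)

def IsThreshold {n : ℕ} (S : Sig n → St n → ℝ) : Prop :=
  ∃ (Ψ : Finset (Fin n)) (η : ℕ), ∀ σ ω, S σ ω = thresholdScore Ψ η σ ω

end KS

namespace KS

theorem one_add_sum_le_prod_one_add {ι : Type*} (s : Finset ι) (f : ι → ℝ)
    (hf : ∀ i ∈ s, 0 ≤ f i) : 1 + ∑ i ∈ s, f i ≤ ∏ i ∈ s, (1 + f i) := by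
  induction s using Finset.cons_induction with
  | empty => simp
  | cons a s ha ih =>
    rw [sum_cons, prod_cons]
    have h0 := hf a (mem_cons_self a s)
    have hs : ∀ i ∈ s, 0 ≤ f i := fun i hi => hf i (mem_cons_of_mem hi)
    nlinarith [ih hs, sum_nonneg hs, mul_nonneg h0 (sum_nonneg hs)]

section ProductWeights

variable {ι α : Type*} [Fintype ι] [DecidableEq ι] [Fintype α]

theorem sum_prod_mul_prod_eq (w : ι → α → ℝ) (hw : ∀ i, ∑ s, w i s = 1)
    (h : ι → α → ℝ) (t : Finset ι) :
    ∑ σ : ι → α, (∏ i, w i (σ i)) * ∏ i ∈ t, h i (σ i) = ∏ i ∈ t, ∑ s, w i s * h i s := by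
  have key : ∀ σ : ι → α, (∏ i, w i (σ i)) * ∏ i ∈ t, h i (σ i)
      = ∏ i, w i (σ i) * (if i ∈ t then h i (σ i) else 1) := fun σ => by
    rw [prod_mul_distrib, Fintype.prod_ite_mem]
  simp_rw [key]
  rw [← Fintype.prod_sum (fun i s => w i s * (if i ∈ t then h i s else 1)),
    ← Fintype.prod_ite_mem t]
  refine prod_congr rfl fun i _ => ?_
  split_ifs <;> simp [hw]

/-- Pushing a product weight forward along a coordinatewise map. -/
theorem sum_prod_mul_comp [DecidableEq α] (w : ι → α → ℝ) (m : ι → α → α)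
    (F : (ι → α) → ℝ) :
    ∑ τ : ι → α, (∏ i, ∑ s, if m i s = τ i then w i s else 0) * F τ
      = ∑ σ : ι → α, (∏ i, w i (σ i)) * F (fun i => m i (σ i)) := by
  simp_rw [Fintype.prod_sum, sum_mul]
  rw [sum_comm]
  refine sum_congr rfl fun σ _ => ?_
  rw [Fintype.sum_eq_single (fun i => m i (σ i))]
  · simp
  · intro τ hτ
    obtain ⟨i, hi⟩ := Function.ne_iff.mp hτ
    rw [prod_eq_zero (mem_univ i) (if_neg (Ne.symm hi)), zero_mul]

end ProductWeights

variable {n : ℕ}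

theorem postProb_nonneg (σ : Sig n) (ω : St n) : 0 ≤ postProb σ ω := by
  refine prod_nonneg fun i _ => ?_
  cases σ i with
  | none => norm_num
  | some b => simp only [Option.elim_some]; split_ifs <;> norm_num

theorem sum_postProb (σ : Sig n) : ∑ ω, postProb σ ω = 1 := by
  unfold postProb
  rw [← Fintype.prod_sum (fun i b => (σ i).elim ((1:ℝ)/2) (fun b' => if b = b' then 1 else 0))]
  refine prod_eq_one fun i _ => ?_
  cases σ i <;> simp

theorem eq_of_postProb_ne_zero {σ : Sig n} {ω : St n} (h : postProb σ ω ≠ 0) {i : Fin n}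
    {b : Bool} (hb : σ i = some b) : b = ω i := by
  have := prod_ne_zero_iff.mp h i (mem_univ i)
  simp only [hb, Option.elim_some, ne_eq, ite_eq_right_iff, one_ne_zero, imp_false,
    not_not] at this
  exact this.symm

/-- Reward collected on one task for reporting `s` when reports are correct. -/
def reward (x : ℝ) (s : Option Bool) : ℝ := s.elim 0 fun _ => x

/-- Score on one task: `x` for a correct report, a prohibitive penalty for a wrong one. -/
def taskScore (n : ℕ) (x : ℝ) (s : Option Bool) (b : Bool) : ℝ :=
  s.elim 0 fun b' => if b' = b then x else -(n + 1)

noncomputable def penaltyScore (x : Fin n → ℝ) (σ : Sig n) (ω : St n) : ℝ :=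
  min 11 (max 0 (-(-1) + ∑ i, taskScore n (x i) (σ i) (ω i)))

noncomputable def truthfulScore (x : Fin n → ℝ) (σ : Sig n) : ℝ :=
  min 11 (1 + ∑ i, reward (x i) (σ i))

theorem reward_nonneg {x : ℝ} (hx : 0 ≤ x) (s : Option Bool) : 0 ≤ reward x s := by
  cases s <;> simp [reward, hx]

theorem penaltyScore_eq {x : Fin n → ℝ} (hx : ∀ i, 0 ≤ x i) {σ : Sig n} {ω : St n}
    (h : ∀ i b, σ i = some b → b = ω i) : penaltyScore x σ ω = truthfulScore x σ := by
  have hT : ∀ i, taskScore n (x i) (σ i) (ω i) = reward (x i) (σ i) := fun i => by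
    cases hs : σ i with
    | none => rfl
    | some b => simp [taskScore, reward, h i b hs]
  have h0 : 0 ≤ ∑ i, reward (x i) (σ i) := sum_nonneg fun i _ => reward_nonneg (hx i) _
  simp only [penaltyScore, truthfulScore, hT]
  rw [max_eq_right (by linarith), neg_neg]

theorem penaltyScore_eq_zero {x : Fin n → ℝ} (hx : ∀ i, x i ∈ Set.Icc (0:ℝ) 1) {σ : Sig n}
    {ω : St n} {i : Fin n} {b : Bool} (hb : σ i = some b) (hne : b ≠ ω i) :
    penaltyScore x σ ω = 0 := by
  have h1 : ∀ j, taskScore n (x j) (σ j) (ω j) ≤ 1 := fun j => by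
    unfold taskScore
    cases σ j with
    | none => simp
    | some b =>
      simp only [Option.elim_some]
      split_ifs
      · exact (hx j).2
      · have : (0:ℝ) ≤ n := Nat.cast_nonneg n
        linarith
  have h2 : ∑ j ∈ univ.erase i, taskScore n (x j) (σ j) (ω j) ≤ n := by
    refine (sum_le_card_nsmul _ _ 1 fun j _ => h1 j).trans ?_
    rw [nsmul_eq_mul, mul_one]
    exact_mod_cast (card_le_univ _).trans_eq (Fintype.card_fin n)
  have h3 : taskScore n (x i) (σ i) (ω i) = -(n + 1) := by simp [taskScore, hb, hne]
  have h4 : -(-1) + ∑ j, taskScore n (x j) (σ j) (ω j) ≤ 0 := by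
    rw [← add_sum_erase _ _ (mem_univ i), h3]
    linarith
  rw [penaltyScore, max_eq_left h4]
  norm_num

theorem postExp_penaltyScore_self {x : Fin n → ℝ} (hx : ∀ i, 0 ≤ x i) (σ : Sig n) :
    postExp σ (penaltyScore x σ) = truthfulScore x σ := by
  rw [← one_mul (truthfulScore x σ), ← sum_postProb σ, sum_mul]
  refine sum_congr rfl fun ω _ => ?_
  by_cases h : postProb σ ω = 0
  · simp [h]
  · rw [penaltyScore_eq hx fun i b hb => eq_of_postProb_ne_zero h hb]

/-- Likelihood-ratio weight of a guess: a report on a task whose state is unknown is paid double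
when it is right and nothing when it is wrong. -/
def guessWeight (s s' : Option Bool) (b : Bool) : ℝ :=
  s.elim (s'.elim 1 fun b' => if b' = b then 2 else 0) fun _ => 1

theorem guessWeight_nonneg (s s' : Option Bool) (b : Bool) : 0 ≤ guessWeight s s' b := by
  cases s <;> cases s' <;> simp only [guessWeight, Option.elim_none, Option.elim_some] <;>
    (try split_ifs) <;> norm_num

theorem postExp_prod_guessWeight (σ σ' : Sig n) :
    postExp σ (fun ω => ∏ i, guessWeight (σ i) (σ' i) (ω i)) = 1 := by
  unfold postExp postProb
  simp_rw [← prod_mul_distrib]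
  rw [← Fintype.prod_sum (fun i b => (σ i).elim ((1:ℝ)/2) (fun b' => if b = b' then 1 else 0)
    * guessWeight (σ i) (σ' i) b)]
  refine prod_eq_one fun i _ => ?_
  cases σ i with
  | none =>
    cases σ' i with
    | none => simp [guessWeight]
    | some b => cases b <;> simp [guessWeight]
  | some b => simp [guessWeight]

theorem penaltyScore_le {x : Fin n → ℝ} (hx : ∀ i, x i ∈ Set.Icc (0:ℝ) 1) (σ σ' : Sig n)
    (ω : St n) :
    penaltyScore x σ' ω ≤ truthfulScore x σ * ∏ i, guessWeight (σ i) (σ' i) (ω i) := by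
  have hR : 0 ≤ ∑ i, reward (x i) (σ i) := sum_nonneg fun i _ => reward_nonneg (hx i).1 _
  have hG : 1 ≤ truthfulScore x σ := le_min (by norm_num) (by linarith)
  have hW : 0 ≤ ∏ i, guessWeight (σ i) (σ' i) (ω i) :=
    prod_nonneg fun i _ => guessWeight_nonneg _ _ _
  by_cases h : ∀ i b, σ' i = some b → b = ω i
  · rw [penaltyScore_eq (fun i => (hx i).1) h]
    set D : Fin n → ℝ := fun i => guessWeight (σ i) (σ' i) (ω i) - 1 with hD
    have hDi : ∀ i, 0 ≤ D i ∧ reward (x i) (σ' i) ≤ reward (x i) (σ i) + D i := fun i => by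
      have hxi := hx i
      simp only [hD]
      cases hs : σ i <;> cases hs' : σ' i
      · simp [guessWeight, reward]
      · simp only [guessWeight, reward, Option.elim_none, Option.elim_some, h i _ hs', if_true]
        constructor <;> linarith [hxi.1, hxi.2]
      · simp [guessWeight, reward, hxi.1]
      · simp [guessWeight, reward]
    have hprod : 1 + ∑ i, D i ≤ ∏ i, guessWeight (σ i) (σ' i) (ω i) := by
      have := one_add_sum_le_prod_one_add univ D (fun i _ => (hDi i).1)
      simpa [hD] using this
    have hD0 : 0 ≤ ∑ i, D i := sum_nonneg fun i _ => (hDi i).1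
    have hsum : ∑ i, reward (x i) (σ' i) ≤ ∑ i, reward (x i) (σ i) + ∑ i, D i := by
      rw [← sum_add_distrib]
      exact sum_le_sum fun i _ => (hDi i).2
    refine le_trans ?_ (mul_le_mul_of_nonneg_left hprod (zero_le_one.trans hG))
    unfold truthfulScore
    rcases min_cases (11:ℝ) (1 + ∑ i, reward (x i) (σ i)) with ⟨he, -⟩ | ⟨he, -⟩ <;> rw [he]
    · exact (min_le_left _ _).trans (by linarith)
    · exact (min_le_right _ _).trans (by nlinarith)
  · push Not at h
    obtain ⟨i, b, hb, hne⟩ := h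
    rw [penaltyScore_eq_zero hx hb hne]
    exact mul_nonneg (by linarith) hW

theorem proper_penaltyScore {x : Fin n → ℝ} (hx : ∀ i, x i ∈ Set.Icc (0:ℝ) 1) :
    Proper (penaltyScore x) := fun σ σ' => by
  rw [postExp_penaltyScore_self fun i => (hx i).1]
  calc postExp σ (penaltyScore x σ')
      ≤ ∑ ω, truthfulScore x σ * (postProb σ ω * ∏ i, guessWeight (σ i) (σ' i) (ω i)) :=
        sum_le_sum fun ω _ =>
          (mul_le_mul_of_nonneg_left (penaltyScore_le hx σ σ' ω) (postProb_nonneg σ ω)).trans_eq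
            (mul_left_comm _ _ _)
    _ = truthfulScore x σ := by
        rw [← mul_sum]
        exact (congrArg _ (postExp_prod_guessWeight σ σ')).trans (mul_one _)

/-- Probability of signal `s` on a task on which effort is exerted. -/
noncomputable def taskProb (p : ℝ) (s : Option Bool) : ℝ := s.elim (1 - p) fun _ => p / 2

/-- Expectation of `f` over signal profiles when effort is exerted on every task. -/
noncomputable def effortExp (p : Fin n → ℝ) (f : Sig n → ℝ) : ℝ :=
  ∑ σ : Sig n, (∏ i, taskProb (p i) (σ i)) * f σ

theorem sum_taskProb (p : ℝ) : ∑ s, taskProb p s = 1 := by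
  simp [taskProb, Fintype.sum_option]
  ring

theorem sum_taskProb_mul_reward (p x : ℝ) : ∑ s, taskProb p s * reward x s = p * x := by
  simp only [taskProb, reward, Fintype.sum_option, Fintype.sum_bool, Option.elim_none,
    Option.elim_some]
  ring

theorem taskProb_nonneg {p : ℝ} (h0 : 0 ≤ p) (h1 : p ≤ 1) (s : Option Bool) :
    0 ≤ taskProb p s := by
  cases s <;> simp [taskProb] <;> linarith

theorem effortExp_mono {p : Fin n → ℝ} (hp : ∀ i, 0 < p i ∧ p i ≤ 1) {f g : Sig n → ℝ}
    (h : ∀ σ, f σ ≤ g σ) : effortExp p f ≤ effortExp p g :=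
  sum_le_sum fun σ _ => mul_le_mul_of_nonneg_left (h σ)
    (prod_nonneg fun i _ => taskProb_nonneg (hp i).1.le (hp i).2 _)

theorem effortExp_sum {ι : Type*} (p : Fin n → ℝ) (t : Finset ι) (f : ι → Sig n → ℝ) :
    effortExp p (fun σ => ∑ j ∈ t, f j σ) = ∑ j ∈ t, effortExp p (f j) := by
  simp only [effortExp, mul_sum]
  exact sum_comm

theorem effortExp_sub (p : Fin n → ℝ) (f g : Sig n → ℝ) :
    effortExp p (fun σ => f σ - g σ) = effortExp p f - effortExp p g := by
  simp [effortExp, mul_sub]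

theorem effortExp_const_mul (p : Fin n → ℝ) (a : ℝ) (f : Sig n → ℝ) :
    effortExp p (fun σ => a * f σ) = a * effortExp p f := by
  simp only [effortExp, mul_sum]
  exact sum_congr rfl fun σ _ => mul_left_comm _ _ _

theorem effortExp_reward (p x : Fin n → ℝ) (i : Fin n) :
    effortExp p (fun σ => reward (x i) (σ i)) = p i * x i := by
  have := sum_prod_mul_prod_eq (fun i => taskProb (p i)) (fun i => sum_taskProb (p i))
    (fun i => reward (x i)) {i}
  simp only [prod_singleton, sum_taskProb_mul_reward] at this
  exact this

theorem effortExp_reward_mul_reward (p x : Fin n → ℝ) {i j : Fin n} (hij : i ≠ j) :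
    effortExp p (fun σ => reward (x i) (σ i) * reward (x j) (σ j))
      = p i * x i * (p j * x j) := by
  have := sum_prod_mul_prod_eq (fun i => taskProb (p i)) (fun i => sum_taskProb (p i))
    (fun i => reward (x i)) {i, j}
  simp only [prod_pair hij, sum_taskProb_mul_reward] at this
  exact this

theorem effortExp_reward_mul_reward_self_le {p x : Fin n → ℝ} (hp : ∀ i, 0 < p i ∧ p i ≤ 1)
    (hx : ∀ i, x i ∈ Set.Icc (0:ℝ) 1) (i : Fin n) :
    effortExp p (fun σ => reward (x i) (σ i) * reward (x i) (σ i)) ≤ p i * x i := by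
  rw [← effortExp_reward]
  refine effortExp_mono hp fun σ => mul_le_of_le_one_right (reward_nonneg (hx i).1 _) ?_
  cases σ i <;> simp [reward, (hx i).2]

theorem effortExp_reward_mul_sum_le {p x : Fin n → ℝ} (hp : ∀ i, 0 < p i ∧ p i ≤ 1)
    (hx : ∀ i, x i ∈ Set.Icc (0:ℝ) 1) (i : Fin n) :
    effortExp p (fun σ => reward (x i) (σ i) * ∑ j, reward (x j) (σ j))
      ≤ p i * x i * (1 + ∑ j, p j * x j) := by
  have h0 : ∀ j, 0 ≤ p j * x j := fun j => mul_nonneg (hp j).1.le (hx j).1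
  simp_rw [mul_sum]
  rw [effortExp_sum, ← add_sum_erase _ _ (mem_univ i),
    ← add_sum_erase univ (fun j => p j * x j) (mem_univ i),
    sum_congr rfl fun j hj => effortExp_reward_mul_reward p x (ne_of_mem_erase hj).symm,
    ← mul_sum]
  nlinarith [effortExp_reward_mul_reward_self_le hp hx i, mul_nonneg (h0 i) (h0 i)]

/-- The signal profile seen when the effort spent outside `A` is discarded. -/
def mask (A : Finset (Fin n)) (σ : Sig n) : Sig n := fun i => if i ∈ A then σ i else none

theorem expScore_eq_effortExp (p : Fin n → ℝ) (A : Finset (Fin n))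
    (S : Sig n → St n → ℝ) :
    expScore p A S = effortExp p (fun σ => postExp (mask A σ) (S (mask A σ))) := by
  have := sum_prod_mul_comp (fun i => taskProb (p i))
    (fun i s => if i ∈ A then s else none) (fun σ => postExp σ (S σ))
  unfold effortExp mask
  rw [← this]
  refine sum_congr rfl fun σ _ => ?_
  congr 1
  refine prod_congr rfl fun i _ => ?_
  by_cases hi : i ∈ A
  · simp [hi, taskProb]
  · simp only [hi, if_false]
    cases σ i with
    | none => simpa using (sum_taskProb (p i)).symm
    | some b => simp

theorem sum_reward_mask (x : Fin n → ℝ) (A : Finset (Fin n)) (σ : Sig n) :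
    ∑ i, reward (x i) (mask A σ i) = ∑ i ∈ A, reward (x i) (σ i) := by
  rw [← Fintype.sum_ite_mem A]
  refine sum_congr rfl fun i _ => ?_
  unfold mask
  split_ifs <;> simp [reward]


theorem sub_mul_le_min_sub_min {y z : ℝ} (hz0 : 0 ≤ z) (hz : z ≤ y) :
    (y - z) * (1 - y / 10) ≤ min 11 (1 + y) - min 11 (1 + z) := by
  rcases le_total y 10 with h | h
  · rw [min_eq_right (by linarith), min_eq_right (by linarith)]
    nlinarith
  · have := min_le_min_left (11:ℝ) (add_le_add_right hz 1)
    nlinarith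

theorem expScore_penaltyScore_sub_ge {p x : Fin n → ℝ} (hp : ∀ i, 0 < p i ∧ p i ≤ 1)
    (hx : ∀ i, x i ∈ Set.Icc (0:ℝ) 1) (hm : ∑ i, p i * x i ≤ 2) {Ψ : Finset (Fin n)}
    (hΨ : ∀ i, i ∉ Ψ → x i = 0) (A : Finset (Fin n)) :
    7 / 10 * ∑ i ∈ Aᶜ, p i * x i
      ≤ expScore p Ψ (penaltyScore x) - expScore p A (penaltyScore x) := by
  have hx0 : ∀ i, 0 ≤ x i := fun i => (hx i).1
  rw [expScore_eq_effortExp, expScore_eq_effortExp, ← effortExp_sub]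
  simp only [postExp_penaltyScore_self hx0, truthfulScore, sum_reward_mask]
  have hfull : ∀ σ : Sig n, ∑ i ∈ Ψ, reward (x i) (σ i) = ∑ i, reward (x i) (σ i) := fun σ =>
    sum_subset (subset_univ _) fun i _ hi => by
      rw [hΨ i hi]; cases σ i <;> rfl
  have hpt : ∀ σ : Sig n,
      ∑ i ∈ Aᶜ, (reward (x i) (σ i)
          - 1 / 10 * (reward (x i) (σ i) * ∑ j, reward (x j) (σ j)))
        ≤ min 11 (1 + ∑ i ∈ Ψ, reward (x i) (σ i))
          - min 11 (1 + ∑ i ∈ A, reward (x i) (σ i)) := fun σ => by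
    have hsplit := sum_add_sum_compl A fun i => reward (x i) (σ i)
    have hc : 0 ≤ ∑ i ∈ Aᶜ, reward (x i) (σ i) := sum_nonneg fun i _ => reward_nonneg (hx0 i) _
    have hA : 0 ≤ ∑ i ∈ A, reward (x i) (σ i) := sum_nonneg fun i _ => reward_nonneg (hx0 i) _
    rw [hfull, sum_sub_distrib, ← mul_sum, ← sum_mul]
    refine le_trans (le_of_eq ?_)
      (sub_mul_le_min_sub_min (y := ∑ i, reward (x i) (σ i)) (z := ∑ i ∈ A, reward (x i) (σ i))
        hA (by linarith))
    rw [← hsplit]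
    ring
  refine le_trans ?_ (effortExp_mono hp hpt)
  rw [effortExp_sum, mul_sum]
  refine sum_le_sum fun i _ => ?_
  rw [effortExp_sub, effortExp_const_mul, effortExp_reward]
  have h0 : 0 ≤ p i * x i := mul_nonneg (hp i).1.le (hx0 i)
  nlinarith [effortExp_reward_mul_sum_le hp hx i]

end KS

/-- Bicriteria approximation via budget inflation: with additive values and
`p i ≥ 2 c i`, there is a proper truncated separate scoring rule with values in
`[0, 11]` incentivizing a set `Ψ` whose value is at least the optimal knapsack
value `ALG-OPT` with budget 1. -/
theorem stmt4 {n : ℕ} (p c v : Fin n → ℝ)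
    (hp : ∀ i, 0 < p i ∧ p i ≤ 1) (hc : ∀ i, 0 < c i) (hv : ∀ i, 0 ≤ v i)
    (hpc : ∀ i, 2 * c i ≤ p i) :
    ∃ (Ψ : Finset (Fin n)) (S : KS.Sig n → KS.St n → ℝ),
      KS.IsTruncSep 11 S ∧
      (∀ σ ω, S σ ω ∈ Set.Icc (0:ℝ) 11) ∧
      KS.IC p c S Ψ ∧
      ∀ Ψ' : Finset (Fin n), ∑ i ∈ Ψ', c i ≤ 1 → ∑ i ∈ Ψ, v i ≥ ∑ i ∈ Ψ', v i := by
  classical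
  obtain ⟨Ψ, hΨ, hmax⟩ := exists_max_image
    (univ.filter fun Ψ : Finset (Fin n) => ∑ i ∈ Ψ, c i ≤ 1) (fun Ψ => ∑ i ∈ Ψ, v i)
    ⟨∅, by simp⟩
  simp only [mem_filter, mem_univ, true_and] at hΨ hmax
  set x : Fin n → ℝ := fun i => if i ∈ Ψ then 2 * c i / p i else 0 with hxdef
  have hx : ∀ i, x i ∈ Set.Icc (0:ℝ) 1 := fun i => by
    simp only [hxdef]
    split_ifs
    · exact ⟨div_nonneg (by linarith [hc i]) (hp i).1.le, (div_le_one (hp i).1).2 (hpc i)⟩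
    · simp
  have hpx : ∀ i, p i * x i = if i ∈ Ψ then 2 * c i else 0 := fun i => by
    simp only [hxdef]
    split_ifs
    · exact mul_div_cancel₀ _ (hp i).1.ne'
    · simp
  have hm : ∑ i, p i * x i ≤ 2 := by
    simp only [hpx, Fintype.sum_ite_mem, ← mul_sum]
    linarith
  refine ⟨Ψ, KS.penaltyScore x, ⟨fun i => KS.taskScore n (x i), -1, fun _ _ => rfl⟩,
    fun σ ω => ⟨le_min (by norm_num) (le_max_left _ _), min_le_left _ _⟩,
    ⟨KS.proper_penaltyScore hx, fun A => ?_⟩, fun Ψ' h => hmax Ψ' h⟩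
  have hgain := KS.expScore_penaltyScore_sub_ge hp hx hm (Ψ := Ψ) (fun i hi => if_neg hi) A
  simp only [hpx, sum_ite_mem, ← mul_sum] at hgain
  have h0 : 0 ≤ ∑ i ∈ Aᶜ ∩ Ψ, c i := sum_nonneg fun i _ => (hc i).le
  have hcost : ∑ i ∈ Ψ, c i ≤ ∑ i ∈ A, c i + ∑ i ∈ Aᶜ ∩ Ψ, c i := by
    rw [← sum_union (disjoint_left.2 fun i hi hi' =>
      mem_compl.1 (mem_of_mem_inter_left hi') hi)]
    refine sum_le_sum_of_subset_of_nonneg (fun i hi => ?_) fun i _ _ => (hc i).le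
    by_cases hA : i ∈ A <;> simp [hA, hi]
  linarith
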